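/- Let q be even and let H be a q-uniform multi-hypergraph on a subset of {1,…,n} with all multiplicities even, and let H₁,…,H_R be its connected components. Then b(H) = (m(H) choose m(H₁),…,m(H_R)) · ∏_{k=1}^R b(H_k), where the first factor is the multinomial coefficient m(H)!/(m(H₁)!⋯m(H_R)!). -/

import Mathlib

open MeasureTheory Filter

noncomputable section

namespace SYK

attribute [local instance] Classical.propDecidable

/-- The quadratic form on `ℂ^N` with `Q(x) = ½ Σ x_i²`, so that the Clifford
relation reads `ψ_i ψ_j + ψ_j ψ_i = δ_{ij}`. -/
def Qf (N : ℕ) : QuadraticForm ℂ (Fin N → ℂ) :=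
  QuadraticMap.weightedSumSquares ℂ (fun _ : Fin N => (1 / 2 : ℂ))

/-- The complex Clifford algebra with `N` Majorana generators. -/
abbrev Cliff (N : ℕ) := CliffordAlgebra (Qf N)

/-- The Majorana generator `ψ_i`. -/
def psi {N : ℕ} (i : Fin N) : Cliff N :=
  CliffordAlgebra.ι (Qf N) (Pi.single i 1)

/-- `ψ_I = i^{q/2} ψ_{i₁} ⋯ ψ_{i_q}` for `I = {i₁ < ⋯ < i_q}`. -/
def psiSet {N : ℕ} (q : ℕ) (I : Finset (Fin N)) : Cliff N :=
  (Complex.I) ^ (q / 2) • ((I.sort (· ≤ ·)).map psi).prod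

/-- The sign `B(I₁,…,I_m) ∈ {±1}` determined by
`ψ_{I₁} ⋯ ψ_{I_m} = B(I₁,…,I_m) 2^{-qm/2} 1`. -/
def signB {N : ℕ} (q : ℕ) (l : List (Finset (Fin N))) : ℝ :=
  if (l.map (psiSet q)).prod = (((2 : ℂ) ^ (q * l.length / 2))⁻¹) • (1 : Cliff N) then 1 else -1

/-- `b(H) = Σ_{(I₁,…,I_m) ∈ w(H)} B(I₁,…,I_m)` for a multi-hypergraph with
multiplicity function `r` and total multiplicity `m`, the sum running over
all ordered sequences in which each hyperedge `e` appears exactly `r e` times. -/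
def bMulti {N : ℕ} (q : ℕ) (r : Finset (Fin N) → ℕ) (m : ℕ) : ℝ :=
  ∑ f : Fin m → Finset (Fin N),
    if (∀ e, (Finset.univ.filter (fun i => f i = e)).card = r e)
    then signB q (List.ofFn f) else 0

/-- Two ring elements agree up to sign. -/
def EqUpToSign {A : Type*} [Ring A] (x y : A) : Prop := x = y ∨ x = -y

namespace EqUpToSign

variable {A : Type*} [Ring A] {x y z w : A}

theorem refl (x : A) : EqUpToSign x x := Or.inl rfl

theorem trans (h : EqUpToSign x y) (h' : EqUpToSign y z) : EqUpToSign x z := by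
  rcases h with rfl | rfl <;> rcases h' with rfl | rfl <;> simp [EqUpToSign]

theorem mul (h : EqUpToSign x y) (h' : EqUpToSign z w) : EqUpToSign (x * z) (y * w) := by
  rcases h with rfl | rfl <;> rcases h' with rfl | rfl <;> simp [EqUpToSign]

theorem mul_prod_comm {l : List A} (h : ∀ y ∈ l, EqUpToSign (x * y) (y * x)) :
    EqUpToSign (x * l.prod) (l.prod * x) := by
  induction l with
  | nil => simp [EqUpToSign]
  | cons a l ih =>
    have h₁ := (h a (by simp)).mul (refl l.prod)
    have h₂ := (refl a).mul (ih fun y hy => h y (by simp [hy]))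
    simp only [List.prod_cons, mul_assoc] at h₁ h₂ ⊢
    exact h₁.trans h₂

theorem prod_mul_prod_comm {l l' : List A}
    (h : ∀ x ∈ l, ∀ y ∈ l', EqUpToSign (x * y) (y * x)) :
    EqUpToSign (l.prod * l'.prod) (l'.prod * l.prod) := by
  induction l with
  | nil => simp [EqUpToSign]
  | cons a l ih =>
    have h₁ := (refl a).mul (ih fun x hx => h x (by simp [hx]))
    have h₂ := (mul_prod_comm (h a (by simp))).mul (refl l.prod)
    simp only [List.prod_cons, mul_assoc] at h₁ h₂ ⊢
    exact h₁.trans h₂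

theorem prod_map_of_perm {α : Type*} (f : α → A)
    (h : ∀ a b, EqUpToSign (f a * f b) (f b * f a)) {l l' : List α} (p : l.Perm l') :
    EqUpToSign (l.map f).prod (l'.map f).prod := by
  induction p with
  | nil => exact refl _
  | cons a _ ih => simpa using (refl (f a)).mul ih
  | swap a b l => simpa [mul_assoc] using (h b a).mul (refl (l.map f).prod)
  | trans _ _ ih ih' => exact ih.trans ih'

end EqUpToSign

theorem mul_prod_eq_neg_one_pow_smul {A : Type*} [Ring A] {x : A} {l : List A}
    (h : ∀ y ∈ l, x * y = -(y * x)) : x * l.prod = (-1) ^ l.length * (l.prod * x) := by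
  induction l with
  | nil => simp
  | cons a l ih =>
    have ih' := ih fun y hy => h y (by simp [hy])
    rw [List.prod_cons, ← mul_assoc, h a (by simp), neg_mul, mul_assoc, ih', List.length_cons,
      pow_succ, ← mul_assoc a, ← ((Commute.one_left a).neg_left.pow_left l.length).eq]
    simp [mul_assoc]

theorem psi_mul_self {N : ℕ} (i : Fin N) :
    psi i * psi i = algebraMap ℂ (Cliff N) (1 / 2) := by
  rw [psi, CliffordAlgebra.ι_sq_scalar]
  congr 1
  simp [Qf, QuadraticMap.weightedSumSquares_apply, Pi.single_apply]

theorem psi_mul_psi_of_ne {N : ℕ} {i j : Fin N} (h : i ≠ j) :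
    psi i * psi j = -(psi j * psi i) := by
  rw [eq_neg_iff_add_eq_zero, psi, psi, CliffordAlgebra.ι_mul_ι_add_swap]
  convert map_zero (algebraMap ℂ (Cliff N))
  simp [QuadraticMap.polar, Qf, QuadraticMap.weightedSumSquares_apply, Pi.single_apply, mul_add,
    Finset.sum_add_distrib, h, h.symm]

theorem psi_mul_psi_comm_upToSign {N : ℕ} (i j : Fin N) :
    EqUpToSign (psi i * psi j) (psi j * psi i) := by
  by_cases h : i = j
  · exact Or.inl (by rw [h])
  · exact Or.inr (psi_mul_psi_of_ne h)

theorem psiSet_mul_psiSet_comm_upToSign {N : ℕ} (q : ℕ) (I J : Finset (Fin N)) :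
    EqUpToSign (psiSet q I * psiSet q J) (psiSet q J * psiSet q I) := by
  have h : EqUpToSign (((I.sort (· ≤ ·)).map (psi (N := N))).prod * ((J.sort (· ≤ ·)).map psi).prod)
      (((J.sort (· ≤ ·)).map psi).prod * ((I.sort (· ≤ ·)).map psi).prod) := by
    apply EqUpToSign.prod_mul_prod_comm
    simp only [List.mem_map]
    rintro _ ⟨i, _, rfl⟩ _ ⟨j, _, rfl⟩
    exact psi_mul_psi_comm_upToSign i j
  simp only [psiSet, smul_mul_smul_comm]
  rcases h with h | h <;> simp [EqUpToSign, h]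

theorem psiSet_commute_of_disjoint {N q : ℕ} {I J : Finset (Fin N)} (hJ : Even J.card)
    (h : I ∩ J = ∅) : Commute (psiSet q I) (psiSet q J) := by
  refine (Commute.smul_right (Commute.smul_left ?_ _) _)
  apply Commute.list_prod_left
  simp only [List.mem_map]
  rintro _ ⟨i, hi, rfl⟩
  rw [Finset.mem_sort] at hi
  rw [commute_iff_eq, mul_prod_eq_neg_one_pow_smul, List.length_map, Finset.length_sort,
    hJ.neg_one_pow, one_mul]
  simp only [List.mem_map]
  rintro _ ⟨j, hj, rfl⟩
  rw [Finset.mem_sort] at hj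
  refine psi_mul_psi_of_ne ?_
  rintro rfl
  simpa [h] using Finset.mem_inter.2 ⟨hi, hj⟩

theorem prod_map_psi_mul_self {N : ℕ} (l : List (Fin N)) :
    EqUpToSign ((l.map psi).prod * (l.map psi).prod)
      (algebraMap ℂ (Cliff N) ((1 / 2) ^ l.length)) := by
  induction l with
  | nil => simp [EqUpToSign]
  | cons a l ih =>
    have h₁ : EqUpToSign ((l.map psi).prod * psi a) (psi a * (l.map psi).prod) := by
      have := EqUpToSign.prod_mul_prod_comm (l := l.map psi) (l' := [psi a]) (by
        simp only [List.mem_map, List.mem_singleton]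
        rintro _ ⟨i, _, rfl⟩ _ rfl
        exact psi_mul_psi_comm_upToSign i a)
      simpa using this
    have h₂ := ((EqUpToSign.refl (psi a)).mul h₁).mul (EqUpToSign.refl (l.map psi).prod)
    have h₃ := (EqUpToSign.refl (psi a * psi a)).mul ih
    rw [psi_mul_self, ← map_mul, ← pow_succ'] at h₃
    rw [← psi_mul_self] at h₃
    simp only [List.map_cons, List.prod_cons, List.length_cons, mul_assoc] at h₂ h₃ ⊢
    exact h₂.trans h₃

theorem psiSet_mul_self {N q : ℕ} {I : Finset (Fin N)} (hI : I.card = q) :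
    EqUpToSign (psiSet q I * psiSet q I) (algebraMap ℂ (Cliff N) ((2 ^ q)⁻¹)) := by
  have h := prod_map_psi_mul_self (I.sort (· ≤ ·))
  have hs : Complex.I ^ (q / 2) * Complex.I ^ (q / 2) = (-1) ^ (q / 2) := by
    rw [← mul_pow, Complex.I_mul_I]
  rw [Finset.length_sort, hI, one_div, inv_pow] at h
  rw [psiSet, smul_mul_smul_comm, hs]
  rcases neg_one_pow_eq_or ℂ (q / 2) with h' | h' <;> rcases h with h | h <;>
    simp only [EqUpToSign, h', h] <;> simp

theorem prod_map_psiSet_upToSign {N q : ℕ} (hq : Even q) :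
    ∀ (m : ℕ) (l : List (Finset (Fin N))), l.length = m → (∀ e ∈ l, e.card = q) →
      (∀ e, Even (l.count e)) →
      EqUpToSign (l.map (psiSet q)).prod (algebraMap ℂ (Cliff N) ((2 ^ (q * m / 2))⁻¹)) := by
  intro m
  induction m using Nat.strong_induction_on with
  | _ m ih =>
  intro l hl hc he
  cases l with
  | nil => subst hl; simp [EqUpToSign]
  | cons a t =>
    have hat : a ∈ t := by
      have := he a
      rw [List.count_cons_self, Nat.even_add_one, Nat.not_even_iff_odd] at this
      exact List.count_pos_iff.1 this.pos
    have hp : (a :: t).Perm (a :: a :: t.erase a) := (List.perm_cons_erase hat).cons a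
    have hlen : (t.erase a).length + 2 = m := by
      rw [← hl, hp.length_eq]; rfl
    have h₁ := EqUpToSign.prod_map_of_perm (psiSet q) (psiSet_mul_psiSet_comm_upToSign q) hp
    have h₂ := ih (t.erase a).length (by omega) (t.erase a) rfl
      (fun e h => hc e (List.mem_cons_of_mem _ (List.mem_of_mem_erase h)))
      (fun e => by
        have := he e
        rw [hp.count_eq, List.count_cons, List.count_cons] at this
        split_ifs at this
        · simpa [add_assoc, Nat.even_add] using this
        · simpa using this)
    have h₃ := (psiSet_mul_self (hc a (by simp))).mul h₂
    have hexp : q * m / 2 = q + q * (t.erase a).length / 2 := by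
      rw [← hlen]
      obtain ⟨c, rfl⟩ := hq
      rw [show (c + c) * ((t.erase a).length + 2)
        = (c + c) * (t.erase a).length + 2 * (c + c) by ring]
      omega
    rw [← map_mul, ← mul_inv, ← pow_add, ← hexp] at h₃
    simp only [List.map_cons, List.prod_cons, ← mul_assoc] at h₁ h₃ ⊢
    exact h₁.trans h₃

theorem prod_map_psiSet_eq_signB {N q : ℕ} (hq : Even q) {l : List (Finset (Fin N))}
    (hc : ∀ e ∈ l, e.card = q) (he : ∀ e, Even (l.count e)) :
    (l.map (psiSet q)).prod =
      algebraMap ℂ (Cliff N) ((signB q l : ℂ) * (2 ^ (q * l.length / 2))⁻¹) := by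
  have h := prod_map_psiSet_upToSign hq l.length l rfl hc he
  rw [signB]
  split_ifs with h'
  · rw [h', Algebra.algebraMap_eq_smul_one]
    simp
  · rw [← Algebra.algebraMap_eq_smul_one] at h'
    rw [h.resolve_left h']
    simp

theorem card_filter_cons_eq {α : Type*} {m : ℕ} (a : α) (f : Fin m → α) (e : α) :
    (Finset.univ.filter (fun i => (Fin.cons a f : Fin (m + 1) → α) i = e)).card =
      (Pi.single a 1 : α → ℕ) e + (Finset.univ.filter (fun i => f i = e)).card := by
  rw [Finset.card_filter, Fin.sum_univ_succ, Finset.card_filter]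
  simp [Pi.single_apply, eq_comm]

/-- The sum of the products `x (f 0) * ⋯ * x (f (m - 1))` over all words `f` of length `m` in
which each letter `e` occurs exactly `r e` times. -/
def wordSum {α A : Type*} [Fintype α] [Ring A] (x : α → A) (r : α → ℕ) (m : ℕ) : A :=
  ∑ f : Fin m → α,
    if (∀ e, (Finset.univ.filter (fun i => f i = e)).card = r e)
    then ((List.ofFn f).map x).prod else 0

section WordSum

variable {α A : Type*} [Fintype α] [Ring A] (x : α → A)

theorem wordSum_zero : wordSum x 0 0 = 1 := by
  simp [wordSum]

theorem wordSum_succ (r : α → ℕ) (m : ℕ) :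
    wordSum x r (m + 1) =
      ∑ a, if r a = 0 then 0 else x a * wordSum x (r - Pi.single a 1) m := by
  rw [wordSum, ← (Fin.consEquiv fun _ : Fin (m + 1) => α).sum_comp, Fintype.sum_prod_type]
  refine Finset.sum_congr rfl fun a _ => ?_
  simp only [Fin.consEquiv_apply, card_filter_cons_eq]
  split_ifs with ha
  · refine Finset.sum_eq_zero fun f _ => if_neg fun h => ?_
    have := h a
    simp [ha] at this
  · rw [wordSum, Finset.mul_sum]
    refine Finset.sum_congr rfl fun f _ => ?_
    have hiff : (∀ e, (Pi.single a 1 : α → ℕ) e +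
        (Finset.univ.filter (fun i => f i = e)).card = r e) ↔
        ∀ e, (Finset.univ.filter (fun i => f i = e)).card = (r - Pi.single a 1 : α → ℕ) e := by
      refine forall_congr' fun e => ?_
      rw [Pi.sub_apply]
      by_cases h : e = a
      · subst h; simp only [Pi.single_eq_same]; omega
      · simp [Pi.single_eq_of_ne h]
    simp only [hiff]
    split_ifs <;> simp [List.ofFn_succ]

theorem sum_sub_single {r : α → ℕ} {a : α} (ha : r a ≠ 0) :
    ∑ e, (r - Pi.single a 1 : α → ℕ) e + 1 = ∑ e, r e := by
  have h : r = (r - Pi.single a 1) + Pi.single a 1 := by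
    ext e
    by_cases h : e = a
    · subst h; simp; omega
    · simp [Pi.single_eq_of_ne h]
  conv_rhs => rw [h]
  simp [Finset.sum_add_distrib]

theorem commute_wordSum {y : A} :
    ∀ (m : ℕ) (r : α → ℕ), (∀ e, r e ≠ 0 → Commute y (x e)) → Commute y (wordSum x r m) := by
  intro m r h
  refine Commute.sum_right _ _ _ fun f _ => ?_
  split_ifs with hf
  · apply Commute.list_prod_right
    simp only [List.mem_map, List.mem_ofFn]
    rintro _ ⟨_, ⟨i, rfl⟩, rfl⟩
    refine h _ ?_
    rw [← hf]
    exact (Finset.card_pos.2 ⟨i, by simp⟩).ne'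
  · exact Commute.zero_right _

theorem wordSum_add (m : ℕ) (r s : α → ℕ) (hm : ∑ e, r e + ∑ e, s e = m)
    (hrs : ∀ e, r e = 0 ∨ s e = 0)
    (hcomm : ∀ e e', r e ≠ 0 → s e' ≠ 0 → Commute (x e) (x e')) :
    wordSum x (r + s) m = (m.choose (∑ e, r e) : A) *
      (wordSum x r (∑ e, r e) * wordSum x s (∑ e, s e)) := by
  induction m generalizing r s with
  | zero =>
    have hr : r = 0 := by ext e; simp at hm; simp [hm.1]
    have hs : s = 0 := by ext e; simp at hm; simp [hm.2]
    subst hr hs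
    simp [wordSum_zero]
  | succ m ih =>
    rcases hr : ∑ e, r e with _ | u
    · have : r = 0 := by ext e; simp at hr; simp [hr]
      subst this
      rw [hr, zero_add] at hm
      simp [wordSum_zero, hm]
    rcases hs : ∑ e, s e with _ | v
    · have : s = 0 := by ext e; simp at hs; simp [hs]
      subst this
      rw [hs, hr, add_zero] at hm
      simp [wordSum_zero, hm]
    have huv : m = u + 1 + v := by omega
    have key : ∀ a, (if (r + s) a = 0 then 0 else x a * wordSum x (r + s - Pi.single a 1) m) =
        (m.choose u : A) * ((if r a = 0 then 0 else x a * wordSum x (r - Pi.single a 1) u) *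
            wordSum x s (v + 1)) +
        (m.choose (u + 1) : A) * (wordSum x r (u + 1) *
          (if s a = 0 then 0 else x a * wordSum x (s - Pi.single a 1) v)) := by
      intro a
      by_cases hra : r a = 0
      · by_cases hsa : s a = 0
        · simp [hra, hsa]
        · have hv := sum_sub_single hsa
          have hle : ∀ e, (s - Pi.single a 1 : α → ℕ) e ≠ 0 → s e ≠ 0 := by
            intro e he h0
            simp [h0] at he
          have hsub : r + s - Pi.single a 1 = r + (s - Pi.single a 1) := by
            ext e
            by_cases h : e = a
            · subst h; simp [hra]
            · simp [Pi.single_eq_of_ne h]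
          have := ih r (s - Pi.single a 1) (by omega)
            (fun e => (hrs e).imp id fun h => by simp [h])
            (fun e e' he he' => hcomm e e' he (hle e' he'))
          have hc : Commute (x a) (wordSum x r (u + 1)) :=
            commute_wordSum x _ _ fun e he => (hcomm e a he hsa).symm
          have hv' : ∑ e, (s - Pi.single a 1 : α → ℕ) e = v := by omega
          rw [hv', hr] at this
          rw [if_neg (by simp [hsa]), if_pos hra, if_neg hsa, hsub, this, ← mul_assoc,
            ← Nat.cast_comm, mul_assoc, ← mul_assoc (x a), hc.eq]
          simp [mul_assoc]
      · have hsa : s a = 0 := (hrs a).resolve_left hra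
        have hv := sum_sub_single hra
        have hle : ∀ e, (r - Pi.single a 1 : α → ℕ) e ≠ 0 → r e ≠ 0 := by
          intro e he h0
          simp [h0] at he
        have hsub : r + s - Pi.single a 1 = (r - Pi.single a 1) + s := by
          ext e
          by_cases h : e = a
          · subst h; simp [hsa]
          · simp [Pi.single_eq_of_ne h]
        have := ih (r - Pi.single a 1) s (by omega)
          (fun e => (hrs e).imp (fun h => by simp [h]) id)
          (fun e e' he he' => hcomm e e' (hle e he) he')
        have hv' : ∑ e, (r - Pi.single a 1 : α → ℕ) e = u := by omega
        rw [hv', hs] at this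
        rw [if_neg (by simp [hra]), if_neg hra, if_pos hsa, hsub, this, ← mul_assoc,
          ← Nat.cast_comm, mul_assoc]
        simp [mul_assoc]
    rw [wordSum_succ, Finset.sum_congr rfl fun a _ => key a, Finset.sum_add_distrib,
      ← Finset.mul_sum, ← Finset.mul_sum, ← Finset.sum_mul, ← Finset.mul_sum,
      ← wordSum_succ, ← wordSum_succ, ← add_mul, Nat.choose_succ_succ, Nat.cast_add]

end WordSum

theorem wordSum_psiSet_eq_bMulti {N q : ℕ} (hq : Even q) (r : Finset (Fin N) → ℕ)
    (hcard : ∀ e, r e ≠ 0 → e.card = q) (heven : ∀ e, Even (r e)) (m : ℕ) :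
    wordSum (psiSet q) r m =
      algebraMap ℂ (Cliff N) ((bMulti q r m : ℂ) * (2 ^ (q * m / 2))⁻¹) := by
  rw [wordSum, bMulti, Complex.ofReal_sum, Finset.sum_mul, map_sum]
  refine Finset.sum_congr rfl fun f _ => ?_
  by_cases hf : ∀ e, (Finset.univ.filter (fun i => f i = e)).card = r e
  · rw [if_pos (by convert hf), if_pos hf]
    have hcount : ∀ e, (List.ofFn f).count e = r e := by
      intro e
      rw [← hf e, ← Multiset.coe_count, ← Fin.univ_val_map, Multiset.count_map, Finset.card_def,
        Finset.filter_val]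
      simp only [eq_comm]
    rw [prod_map_psiSet_eq_signB hq, List.length_ofFn]
    · intro e he
      refine hcard e ?_
      rw [← hcount]
      exact (List.count_pos_iff.2 he).ne'
    · intro e
      rw [hcount]
      exact heven e
  · rw [if_neg (by convert hf), if_neg hf]
    simp

theorem bMulti_add {N q : ℕ} (hq : Even q) (hq0 : q ≠ 0) (r s : Finset (Fin N) → ℕ)
    (hr : ∀ e, r e ≠ 0 → e.card = q) (hs : ∀ e, s e ≠ 0 → e.card = q)
    (hr' : ∀ e, Even (r e)) (hs' : ∀ e, Even (s e))
    (hdisj : ∀ e₁ e₂, r e₁ ≠ 0 → s e₂ ≠ 0 → e₁ ∩ e₂ = ∅) :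
    bMulti q (r + s) (∑ e, r e + ∑ e, s e) =
      ((∑ e, r e + ∑ e, s e).choose (∑ e, r e) : ℝ) *
        (bMulti q r (∑ e, r e) * bMulti q s (∑ e, s e)) := by
  have hrs : ∀ e, r e = 0 ∨ s e = 0 := by
    intro e
    by_contra! h
    have h₁ := hdisj e e h.1 h.2
    rw [Finset.inter_self] at h₁
    have h₂ := hr e h.1
    rw [h₁, Finset.card_empty] at h₂
    exact hq0 h₂.symm
  have h := wordSum_add (psiSet q) _ r s rfl hrs fun e e' he he' =>
    psiSet_commute_of_disjoint (by rwa [hs e' he']) (hdisj e e' he he')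
  rw [wordSum_psiSet_eq_bMulti hq _ hr hr', wordSum_psiSet_eq_bMulti hq _ hs hs',
    wordSum_psiSet_eq_bMulti hq (r + s)
      (fun e he => (hrs e).elim (fun h0 => hs e (by simpa [h0] using he))
        fun h0 => hr e (by simpa [h0] using he))
      (fun e => (hr' e).add (hs' e)), ← map_mul, ← map_natCast (algebraMap ℂ (Cliff N)),
    ← map_mul] at h
  have h' := (algebraMap ℂ (Cliff N)).injective h
  obtain ⟨c, rfl⟩ := hq
  have hexp : ∀ m, (c + c) * m / 2 = c * m := fun m => by
    rw [← two_mul, mul_assoc, Nat.mul_div_cancel_left _ two_pos]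
  simp only [hexp, mul_add c, pow_add, mul_inv] at h'
  have hne : ∀ k : ℕ, ((2 : ℂ) ^ k) ≠ 0 := fun k => pow_ne_zero _ two_ne_zero
  field_simp at h'
  rw [← mul_assoc]
  exact_mod_cast h'

theorem bMulti_zero {N : ℕ} (q : ℕ) : bMulti q (0 : Finset (Fin N) → ℕ) 0 = 1 := by
  simp [bMulti, signB]

/-- `b(H)` factorizes over the connected components `H₁,…,H_R` of a
multi-hypergraph `H` with even multiplicities:
`b(H) = (m(H) choose m(H₁),…,m(H_R)) ∏_k b(H_k)`. The components are given as a
decomposition of the multiplicity function `r` into vertex-disjoint connected parts. -/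
theorem bMulti_factorization (q n : ℕ) (hq : Even q) (hq2 : 2 ≤ q) (hn : q ≤ n)
    (r : Finset (Fin n) → ℕ)
    (hcard : ∀ e, r e ≠ 0 → e.card = q) (heven : ∀ e, Even (r e))
    (R : ℕ) (rs : Fin R → Finset (Fin n) → ℕ)
    (hsum : ∀ e, r e = ∑ k, rs k e)
    (heven' : ∀ k e, Even (rs k e))
    (hconn : ∀ k, ∀ a b : Fin n,
      (∃ e, rs k e ≠ 0 ∧ a ∈ e) → (∃ e, rs k e ≠ 0 ∧ b ∈ e) →
        Relation.ReflTransGen (fun x y => ∃ e, rs k e ≠ 0 ∧ x ∈ e ∧ y ∈ e) a b)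
    (hdisj : ∀ k l, k ≠ l → ∀ e₁ e₂, rs k e₁ ≠ 0 → rs l e₂ ≠ 0 → e₁ ∩ e₂ = ∅) :
    bMulti q r (∑ e, r e)
      = (((∑ e, r e).factorial : ℝ) / ∏ k, ((∑ e, rs k e).factorial : ℝ)) *
          ∏ k, bMulti q (rs k) (∑ e, rs k e) := by
  have main : ∀ t : Finset (Fin R),
      bMulti q (∑ k ∈ t, rs k) (∑ k ∈ t, ∑ e, rs k e) =
        ((∑ k ∈ t, ∑ e, rs k e).factorial / ∏ k ∈ t, ((∑ e, rs k e).factorial : ℝ)) *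
          ∏ k ∈ t, bMulti q (rs k) (∑ e, rs k e) := by
    intro t
    have hk : ∀ k e, rs k e ≠ 0 → e.card = q := by
      intro k e h
      refine hcard e fun h0 => h ?_
      rw [hsum, Finset.sum_eq_zero_iff] at h0
      exact h0 k (Finset.mem_univ k)
    induction t using Finset.induction_on with
    | empty => simp [bMulti_zero]
    | insert k t hkt ih =>
      have hex : ∀ e, (∑ l ∈ t, rs l) e ≠ 0 → ∃ l ∈ t, rs l e ≠ 0 := by
        intro e he
        rw [Finset.sum_apply] at he
        exact Finset.exists_ne_zero_of_sum_ne_zero he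
      have hswap : ∑ l ∈ t, ∑ e, rs l e = ∑ e, (∑ l ∈ t, rs l) e := by
        rw [Finset.sum_comm]
        simp
      have h := bMulti_add hq (by omega) (rs k) (∑ l ∈ t, rs l) (hk k)
        (fun e he => by
          obtain ⟨l, _, hl⟩ := hex e he
          exact hk l e hl)
        (heven' k)
        (fun e => by
          rw [Finset.sum_apply]
          exact Finset.even_sum _ fun l _ => heven' l e)
        (fun e₁ e₂ h₁ h₂ => by
          obtain ⟨l, hlt, hl⟩ := hex e₂ h₂
          exact hdisj k l (by rintro rfl; exact hkt hlt) e₁ e₂ h₁ hl)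
      rw [← hswap, ih, Nat.cast_add_choose] at h
      rw [Finset.sum_insert hkt, Finset.sum_insert hkt, Finset.prod_insert hkt,
        Finset.prod_insert hkt, h]
      have hne : ∀ m : ℕ, (m.factorial : ℝ) ≠ 0 := fun m =>
        Nat.cast_ne_zero.2 m.factorial_ne_zero
      have hne' : ∏ l ∈ t, ((∑ e, rs l e).factorial : ℝ) ≠ 0 :=
        Finset.prod_ne_zero_iff.2 fun l _ => hne _
      have := hne (∑ e, rs k e)
      have := hne (∑ l ∈ t, ∑ e, rs l e)
      field_simp
  have hr : r = ∑ k, rs k := by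
    ext e
    rw [hsum, Finset.sum_apply]
  have hm : ∑ e, r e = ∑ k, ∑ e, rs k e := by
    rw [Finset.sum_comm]
    exact Finset.sum_congr rfl fun e _ => hsum e
  rw [hm]
  conv_lhs => rw [hr]
  exact main Finset.univ

end SYK
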